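/- For s ≥ 2 and x_b, x_g ≥ 0 with x_b + x_g ≤ 1 and sqrt(x_b) + sqrt(x_g) > 1, setting x_r = 1 - x_b - x_g, the maximum asymptotic density I_3(K'_{s,s}, (x_b, x_g)) equals (x_r/2)^s · binomial(2s, s). -/

import Mathlib

open Finset

-- A 3-edge-coloring of the complete graph on `Fin N`, colors `0 = blue`, `1 = green`,
-- `2 = red`, given as a symmetric function on ordered pairs.
def IsSymmColoring {N : ℕ} (c : Fin N → Fin N → Fin 3) : Prop := ∀ u v, c u v = c v u

-- The number of pairs `u < v` receiving a given color.
open scoped Classical in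
noncomputable def colorCount {N : ℕ} (c : Fin N → Fin N → Fin 3) (col : Fin 3) : ℕ :=
  (Finset.univ.filter fun p : Fin N × Fin N => p.1 < p.2 ∧ c p.1 p.2 = col).card

-- The number of copies of `K'_{s,t}` in a 3-colored complete graph: pairs of disjoint
-- vertex sets `(A, B)` with `|A| = s`, `|B| = t`, all pairs inside `A` blue, all pairs
-- inside `B` green, and all pairs between `A` and `B` red.
open scoped Classical in
noncomputable def kstCopies (s t : ℕ) {N : ℕ} (c : Fin N → Fin N → Fin 3) : ℕ :=
  (Finset.univ.filter fun p : Finset (Fin N) × Finset (Fin N) =>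
    p.1.card = s ∧ p.2.card = t ∧ Disjoint p.1 p.2 ∧
    (∀ u ∈ p.1, ∀ v ∈ p.1, u ≠ v → c u v = 0) ∧
    (∀ u ∈ p.2, ∀ v ∈ p.2, u ≠ v → c u v = 1) ∧
    (∀ u ∈ p.1, ∀ v ∈ p.2, c u v = 2)).card

-- `I₃(K'_{s,t}, (x_b, x_g))`: the supremum of limiting `K'_{s,t}`-densities over all
-- good sequences of 3-colored complete graphs with blue density `x_b`, green density `x_g`.
noncomputable def I3 (s t : ℕ) (xb xg : ℝ) : ℝ :=
  sSup { y : ℝ | ∃ (V : ℕ → ℕ) (c : (n : ℕ) → Fin (V n) → Fin (V n) → Fin 3),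
    (∀ n, IsSymmColoring (c n)) ∧
    Filter.Tendsto V Filter.atTop Filter.atTop ∧
    Filter.Tendsto (fun n => (colorCount (c n) 0 : ℝ) / ((V n).choose 2 : ℝ))
      Filter.atTop (nhds xb) ∧
    Filter.Tendsto (fun n => (colorCount (c n) 1 : ℝ) / ((V n).choose 2 : ℝ))
      Filter.atTop (nhds xg) ∧
    Filter.Tendsto (fun n => (kstCopies s t (c n) : ℝ) / ((V n).choose (s + t) : ℝ))
      Filter.atTop (nhds y) }

open Filter Topology

theorem card_lt_pairs {N : ℕ} (S : Finset (Fin N)) :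
    (univ.filter fun p : Fin N × Fin N => p.1 < p.2 ∧ p.1 ∈ S ∧ p.2 ∈ S).card =
      S.card.choose 2 := by
  rw [← card_powersetCard]
  refine card_bij (fun p _ => {p.1, p.2}) ?_ ?_ ?_
  · rintro ⟨u, v⟩ hp
    simp only [mem_filter, mem_univ, true_and] at hp
    simp [mem_powersetCard, insert_subset_iff, hp.2.1, hp.2.2, card_pair hp.1.ne]
  · rintro ⟨u, v⟩ hp ⟨u', v'⟩ hp' he
    simp only [mem_filter, mem_univ, true_and] at hp hp'
    have h1 : u = u' ∨ u = v' := by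
      have := he.subset (mem_insert_self u {v})
      simpa using this
    have h2 : v = u' ∨ v = v' := by
      have := he.subset (mem_insert_of_mem (mem_singleton_self v))
      simpa using this
    have := hp.1
    have := hp'.1
    ext <;> grind
  · intro T hT
    obtain ⟨hTS, hT2⟩ := mem_powersetCard.1 hT
    obtain ⟨u, v, huv, rfl⟩ := card_eq_two.1 hT2
    have hu : u ∈ S := hTS (by simp)
    have hv : v ∈ S := hTS (by simp)
    rcases lt_or_gt_of_ne huv with h | h
    · exact ⟨(u, v), by simp [h, hu, hv], rfl⟩
    · exact ⟨(v, u), by simp [h, hu, hv], pair_comm _ _⟩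

/-- The three color classes partition the edges. -/
theorem sum_colorCount {N : ℕ} (c : Fin N → Fin N → Fin 3) :
    colorCount c 0 + colorCount c 1 + colorCount c 2 = N.choose 2 := by
  classical
  have h := card_lt_pairs (univ : Finset (Fin N))
  rw [card_univ, Fintype.card_fin,
    card_eq_sum_card_fiberwise (f := fun p => c p.1 p.2) (t := univ) (by simp),
    Fin.sum_univ_three] at h
  simpa [colorCount, filter_filter] using h

/-- Two labelled copies of `K'_{s,s}` with the same ordered perfect matching coincide. -/
theorem eq_of_matching_eq {α : Type*} {s : ℕ} (hs : 2 ≤ s) {c : α → α → Fin 3}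
    (hc : ∀ u v, c u v = c v u) {f g f' g' : Fin s → α}
    (hg : ∀ i j, i ≠ j → c (g i) (g j) = 1) (hfg : ∀ i j, c (f i) (g j) = 2)
    (hf' : ∀ i j, i ≠ j → c (f' i) (f' j) = 0)
    (he : ∀ i, s(f i, g i) = s(f' i, g' i)) : f = f' ∧ g = g' := by
  have key : ∀ i, f i = f' i ∧ g i = g' i := by
    intro i
    rcases Sym2.eq_iff.1 (he i) with h | ⟨h1, h2⟩
    · exact h
    · exfalso
      have : Nontrivial (Fin s) := Fin.nontrivial_iff_two_le.2 hs
      obtain ⟨j, hj⟩ := exists_ne i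
      have h0 := hf' i j hj.symm
      rw [← h2] at h0
      rcases Sym2.eq_iff.1 (he j) with ⟨h3, -⟩ | ⟨-, h3⟩
      · rw [← h3, hc, hfg] at h0
        simp at h0
      · rw [← h3, hg i j hj.symm] at h0
        simp at h0
  exact ⟨funext fun i => (key i).1, funext fun i => (key i).2⟩

theorem sym2_eq_of_min_eq_of_max_eq {α : Type*} [LinearOrder α] {a b a' b' : α}
    (h₁ : min a b = min a' b') (h₂ : max a b = max a' b') : s(a, b) = s(a', b') := by
  rw [Sym2.eq_iff]
  rcases le_total a b with h | h <;> rcases le_total a' b' with h' | h' <;> simp_all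

/-- Every copy of `K'_{s,s}` contains `s!²` ordered red perfect matchings, each of which
determines the copy. -/
theorem kstCopies_mul_factorial_sq_le {s N : ℕ} (hs : 2 ≤ s) {c : Fin N → Fin N → Fin 3}
    (hc : IsSymmColoring c) :
    kstCopies s s c * s.factorial ^ 2 ≤ colorCount c 2 ^ s := by
  classical
  unfold kstCopies colorCount
  set K := univ.filter fun p : Finset (Fin N) × Finset (Fin N) =>
    p.1.card = s ∧ p.2.card = s ∧ Disjoint p.1 p.2 ∧
    (∀ u ∈ p.1, ∀ v ∈ p.1, u ≠ v → c u v = 0) ∧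
    (∀ u ∈ p.2, ∀ v ∈ p.2, u ≠ v → c u v = 1) ∧
    (∀ u ∈ p.1, ∀ v ∈ p.2, c u v = 2)
  set R := univ.filter fun p : Fin N × Fin N => p.1 < p.2 ∧ c p.1 p.2 = 2 with hR
  have hKm : ∀ p : K, p.1.1.card = s ∧ p.1.2.card = s ∧ Disjoint p.1.1 p.1.2 ∧
      (∀ u ∈ p.1.1, ∀ v ∈ p.1.1, u ≠ v → c u v = 0) ∧
      (∀ u ∈ p.1.2, ∀ v ∈ p.1.2, u ≠ v → c u v = 1) ∧
      (∀ u ∈ p.1.1, ∀ v ∈ p.1.2, c u v = 2) := fun p =>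
    (mem_filter.1 p.2).2
  let F (x : K × Equiv.Perm (Fin s) × Equiv.Perm (Fin s)) (i : Fin s) : Fin N :=
    x.1.1.1.orderEmbOfFin (hKm x.1).1 (x.2.1 i)
  let G (x : K × Equiv.Perm (Fin s) × Equiv.Perm (Fin s)) (i : Fin s) : Fin N :=
    x.1.1.2.orderEmbOfFin (hKm x.1).2.1 (x.2.2 i)
  have hFm : ∀ x i, F x i ∈ x.1.1.1 := fun x i => orderEmbOfFin_mem _ _ _
  have hGm : ∀ x i, G x i ∈ x.1.1.2 := fun x i => orderEmbOfFin_mem _ _ _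
  have hFi : ∀ x, Function.Injective (F x) := fun x =>
    (orderEmbOfFin _ _).injective.comp x.2.1.injective
  have hGi : ∀ x, Function.Injective (G x) := fun x =>
    (orderEmbOfFin _ _).injective.comp x.2.2.injective
  have hFG : ∀ x i j, c (F x i) (G x j) = 2 := fun x i j =>
    (hKm x.1).2.2.2.2.2 _ (hFm x i) _ (hGm x j)
  have hne : ∀ x i, F x i ≠ G x i := fun x i =>
    disjoint_iff_ne.1 (hKm x.1).2.2.1 _ (hFm x i) _ (hGm x i)
  let Φ (x : K × Equiv.Perm (Fin s) × Equiv.Perm (Fin s)) (i : Fin s) : R :=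
    ⟨(min (F x i) (G x i), max (F x i) (G x i)), by
      rw [hR, mem_filter]
      refine ⟨mem_univ _, min_lt_max.2 (hne x i), ?_⟩
      rcases le_total (F x i) (G x i) with h | h
      · simpa [h] using hFG x i i
      · simpa [h, hc (G x i)] using hFG x i i⟩
  have hΦ : Function.Injective Φ := by
    intro x y hxy
    obtain ⟨hf, hg⟩ := eq_of_matching_eq hs hc (f := F x) (g := G x) (f' := F y) (g' := G y)
      (fun i j hij => (hKm x.1).2.2.2.2.1 _ (hGm x i) _ (hGm x j) ((hGi x).ne hij))
      (hFG x)
      (fun i j hij => (hKm y.1).2.2.2.1 _ (hFm y i) _ (hFm y j) ((hFi y).ne hij))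
      (fun i =>
        have h := Prod.mk.inj (congrArg Subtype.val (congrFun hxy i))
        sym2_eq_of_min_eq_of_max_eq h.1 h.2)
    have hA : ∀ x, x.1.1.1 = univ.image (F x) := fun x =>
      (eq_of_subset_of_card_le (image_subset_iff.2 fun i _ => hFm x i)
        (by rw [card_image_of_injective _ (hFi x), (hKm x.1).1]; simp)).symm
    have hB : ∀ x, x.1.1.2 = univ.image (G x) := fun x =>
      (eq_of_subset_of_card_le (image_subset_iff.2 fun i _ => hGm x i)
        (by rw [card_image_of_injective _ (hGi x), (hKm x.1).2.1]; simp)).symm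
    have h1 : x.1 = y.1 := by
      ext1
      exact Prod.ext (by rw [hA x, hA y, hf]) (by rw [hB x, hB y, hg])
    obtain ⟨p, σ, τ⟩ := x
    obtain ⟨q, σ', τ'⟩ := y
    obtain rfl : p = q := h1
    have h2 : σ = σ' := Equiv.ext fun i => (orderEmbOfFin _ _).injective (congrFun hf i)
    have h3 : τ = τ' := Equiv.ext fun i => (orderEmbOfFin _ _).injective (congrFun hg i)
    rw [h2, h3]
  have := Fintype.card_le_of_injective Φ hΦ
  simpa [Fintype.card_perm, sq] using this

theorem tendsto_choose_div_pow {a N : ℕ → ℕ} {α : ℝ} (hN : Tendsto N atTop atTop)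
    (ha : Tendsto (fun n => (a n : ℝ) / N n) atTop (𝓝 α)) (k : ℕ) :
    Tendsto (fun n => ((a n).choose k : ℝ) / (N n : ℝ) ^ k) atTop
      (𝓝 (α ^ k / k.factorial)) := by
  have hNr : Tendsto (fun n => (N n : ℝ)) atTop atTop :=
    tendsto_natCast_atTop_atTop.comp hN
  have hi : ∀ i : ℕ, Tendsto (fun n => ((a n - i : ℕ) : ℝ) / N n) atTop (𝓝 α) := by
    intro i
    refine tendsto_of_tendsto_of_tendsto_of_le_of_le
      (g := fun n => (a n : ℝ) / N n - i / N n) ?_ ha ?_ ?_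
    · simpa using ha.sub (hNr.const_div_atTop (i : ℝ))
    · intro n
      simp only [← sub_div]
      gcongr
      rw [sub_le_iff_le_add]
      exact_mod_cast le_tsub_add
    · intro n
      simp only
      gcongr
      exact Nat.sub_le _ _
  have hp := (tendsto_finsetProd (range k) fun i _ => hi i).div_const (k.factorial : ℝ)
  rw [prod_const, card_range] at hp
  refine hp.congr fun n => ?_
  rw [Nat.choose_eq_descFactorial_div_factorial,
    Nat.cast_div (Nat.factorial_dvd_descFactorial _ _) (by positivity),
    Nat.descFactorial_eq_prod_range, prod_div_distrib, prod_const, card_range]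
  push_cast
  ring

theorem tendsto_self_choose_div_pow {N : ℕ → ℕ} (hN : Tendsto N atTop atTop) (k : ℕ) :
    Tendsto (fun n => ((N n).choose k : ℝ) / (N n : ℝ) ^ k) atTop (𝓝 (1 / k.factorial)) := by
  have h1 : Tendsto (fun n => (N n : ℝ) / N n) atTop (𝓝 1) := by
    refine tendsto_const_nhds.congr' ?_
    filter_upwards [hN.eventually_gt_atTop 0] with n hn
    rw [div_self (by positivity)]
  simpa using tendsto_choose_div_pow hN h1 k

/-- A count of order `N ^ k` may be normalised by `N.choose k` instead. -/
theorem tendsto_div_choose {N : ℕ → ℕ} (hN : Tendsto N atTop atTop) {k : ℕ} {f : ℕ → ℝ} {l : ℝ}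
    (hf : Tendsto (fun n => f n / (N n : ℝ) ^ k) atTop (𝓝 l)) :
    Tendsto (fun n => f n / ((N n).choose k : ℝ)) atTop (𝓝 (l * k.factorial)) := by
  have h := hf.div (tendsto_self_choose_div_pow hN k) (by positivity)
  rw [one_div, div_inv_eq_mul] at h
  refine h.congr' ?_
  filter_upwards [hN.eventually_gt_atTop 0] with n hn
  exact div_div_div_cancel_right₀ (by positivity) _ _

theorem tendsto_colorCount_two {V : ℕ → ℕ} {c : (n : ℕ) → Fin (V n) → Fin (V n) → Fin 3}
    {xb xg : ℝ} (hV : Tendsto V atTop atTop)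
    (hb : Tendsto (fun n => (colorCount (c n) 0 : ℝ) / ((V n).choose 2 : ℝ)) atTop (𝓝 xb))
    (hg : Tendsto (fun n => (colorCount (c n) 1 : ℝ) / ((V n).choose 2 : ℝ)) atTop (𝓝 xg)) :
    Tendsto (fun n => (colorCount (c n) 2 : ℝ) / ((V n).choose 2 : ℝ)) atTop
      (𝓝 (1 - xb - xg)) := by
  refine ((tendsto_const_nhds.sub hb).sub hg).congr' ?_
  filter_upwards [hV.eventually_ge_atTop 2] with n hn
  have h0 : ((V n).choose 2 : ℝ) ≠ 0 := by exact_mod_cast (Nat.choose_pos hn).ne'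
  have hs : (colorCount (c n) 0 + colorCount (c n) 1 + colorCount (c n) 2 : ℝ) =
    (V n).choose 2 := by exact_mod_cast sum_colorCount (c n)
  field_simp
  linarith

theorem factorial_two_mul_div (s : ℕ) (x : ℝ) :
    (x / 2) ^ s / (s.factorial : ℝ) ^ 2 * (s + s).factorial =
      (x / 2) ^ s * ((2 * s).choose s : ℝ) := by
  rw [two_mul, Nat.cast_add_choose]
  ring

/-- The matching bound, normalised. -/
theorem tendsto_matching_bound {V : ℕ → ℕ} {c : (n : ℕ) → Fin (V n) → Fin (V n) → Fin 3}
    {xr : ℝ} (s : ℕ) (hV : Tendsto V atTop atTop)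
    (hr : Tendsto (fun n => (colorCount (c n) 2 : ℝ) / ((V n).choose 2 : ℝ)) atTop (𝓝 xr)) :
    Tendsto (fun n => ((colorCount (c n) 2 : ℝ) ^ s / (s.factorial : ℝ) ^ 2) /
      ((V n).choose (s + s) : ℝ)) atTop (𝓝 ((xr / 2) ^ s * ((2 * s).choose s : ℝ))) := by
  rw [← factorial_two_mul_div]
  refine tendsto_div_choose hV ?_
  have h := ((hr.mul (tendsto_self_choose_div_pow hV 2)).pow s).div_const
    ((s.factorial : ℝ) ^ 2)
  have h2 : xr * (1 / (Nat.factorial 2 : ℝ)) = xr / 2 := by norm_num; ring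
  rw [h2] at h
  refine h.congr' ?_
  filter_upwards [hV.eventually_ge_atTop 2] with n hn
  have h0 : ((V n).choose 2 : ℝ) ≠ 0 := by exact_mod_cast (Nat.choose_pos hn).ne'
  have h1 : (V n : ℝ) ≠ 0 := by positivity
  rw [div_mul_div_cancel₀ h0, div_pow, ← pow_mul, div_right_comm, two_mul]

theorem kstCopies_le_matching_bound {s N : ℕ} (hs : 2 ≤ s) {c : Fin N → Fin N → Fin 3}
    (hc : IsSymmColoring c) :
    (kstCopies s s c : ℝ) ≤ (colorCount c 2 : ℝ) ^ s / (s.factorial : ℝ) ^ 2 := by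
  rw [le_div_iff₀ (by positivity)]
  exact_mod_cast kstCopies_mul_factorial_sq_le hs hc

/-- The extremal coloring: a blue clique on the first `a` vertices, red edges from it to the
next `b` vertices, and every other edge green. -/
def extremalColoring (a b N : ℕ) (u v : Fin N) : Fin 3 :=
  if u.1 < a ∧ v.1 < a then 0
  else if (u.1 < a ∧ v.1 < a + b) ∨ (v.1 < a ∧ u.1 < a + b) then 2
  else 1

theorem isSymmColoring_extremalColoring (a b N : ℕ) :
    IsSymmColoring (extremalColoring a b N) := by
  intro u v
  simp only [extremalColoring, and_comm (a := u.1 < a) (b := v.1 < a),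
    or_comm (a := u.1 < a ∧ v.1 < a + b)]

theorem card_filter_val_mem_Ico {N x y : ℕ} (hy : y ≤ N) :
    (univ.filter fun u : Fin N => x ≤ u.1 ∧ u.1 < y).card = y - x := by
  rw [← Nat.card_Ico]
  refine card_bij (fun u _ => u.1) (by simp) (fun u _ v _ => Fin.ext) fun m hm => ?_
  have hm := mem_Ico.1 hm
  exact ⟨⟨m, by omega⟩, by simpa using hm, rfl⟩

theorem colorCount_extremalColoring_zero {a b N : ℕ} (h : a + b ≤ N) :
    colorCount (extremalColoring a b N) 0 = a.choose 2 := by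
  have hS := card_filter_val_mem_Ico (N := N) (x := 0) (y := a) (by omega)
  rw [Nat.sub_zero] at hS
  have hp := card_lt_pairs (univ.filter fun u : Fin N => 0 ≤ u.1 ∧ u.1 < a)
  rw [hS] at hp
  rw [← hp, colorCount]
  congr 1
  ext ⟨u, v⟩
  rw [mem_filter]
  simp only [extremalColoring, mem_filter, mem_univ, true_and]
  split_ifs <;> grind

theorem colorCount_extremalColoring_two {a b N : ℕ} (h : a + b ≤ N) :
    colorCount (extremalColoring a b N) 2 = a * b := by
  have hS := card_filter_val_mem_Ico (N := N) (x := 0) (y := a) (by omega)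
  have hT := card_filter_val_mem_Ico (N := N) (x := a) (y := a + b) h
  rw [Nat.sub_zero] at hS
  rw [Nat.add_sub_cancel_left] at hT
  conv_rhs => rw [← hS, ← hT]
  rw [← card_product, colorCount]
  congr 1
  ext ⟨u, v⟩
  rw [mem_filter]
  simp only [extremalColoring, mem_filter, mem_univ, true_and, mem_product, Fin.lt_def]
  split_ifs <;> simp <;> omega

theorem choose_mul_choose_le_kstCopies {a b N : ℕ} (s t : ℕ) (h : a + b ≤ N) :
    a.choose s * b.choose t ≤ kstCopies s t (extremalColoring a b N) := by
  classical
  have hS := card_filter_val_mem_Ico (N := N) (x := 0) (y := a) (by omega)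
  have hT := card_filter_val_mem_Ico (N := N) (x := a) (y := a + b) h
  rw [Nat.sub_zero] at hS
  rw [Nat.add_sub_cancel_left] at hT
  conv_lhs => rw [← hS, ← hT]
  rw [← card_powersetCard, ← card_powersetCard, ← card_product, kstCopies]
  refine card_le_card fun ⟨A, B⟩ hp => ?_
  simp only [mem_product, mem_powersetCard, subset_iff, mem_filter, mem_univ, true_and,
    zero_le] at hp
  obtain ⟨⟨hA, hAs⟩, hB, hBs⟩ := hp
  simp only [mem_filter, mem_univ, true_and]
  refine ⟨hAs, hBs, disjoint_left.2 fun u hu hu' => ?_, fun u hu v hv _ => ?_,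
    fun u hu v hv _ => ?_, fun u hu v hv => ?_⟩
  · have := hA hu
    have := hB hu'
    omega
  · simp [extremalColoring, hA hu, hA hv]
  · have h1 := hB hu
    have h2 := hB hv
    simp [extremalColoring, h1.1.not_gt, h2.1.not_gt]
  · have h1 := hA hu
    have h2 := hB hv
    simp [extremalColoring, h1, h2.1.not_gt, h2.2]

/-- The extremal coloring with parts of relative sizes `α` and `β`. -/
theorem tendsto_extremalColoring {s : ℕ} (hs : 2 ≤ s) {α β : ℝ} (hα : 0 ≤ α) (hβ : 0 ≤ β)
    (hαβ : α + β ≤ 1) :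
    let c := fun n : ℕ => extremalColoring ⌊α * n⌋₊ ⌊β * n⌋₊ n
    Tendsto (fun n => (colorCount (c n) 0 : ℝ) / (n.choose 2 : ℝ)) atTop (𝓝 (α ^ 2)) ∧
    Tendsto (fun n => (colorCount (c n) 1 : ℝ) / (n.choose 2 : ℝ)) atTop
      (𝓝 (1 - α ^ 2 - 2 * α * β)) ∧
    Tendsto (fun n => (kstCopies s s (c n) : ℝ) / (n.choose (s + s) : ℝ)) atTop
      (𝓝 ((2 * α * β / 2) ^ s * ((2 * s).choose s : ℝ))) := by
  intro c
  have hle : ∀ n : ℕ, ⌊α * n⌋₊ + ⌊β * n⌋₊ ≤ n := by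
    intro n
    have h1 := Nat.floor_le (mul_nonneg hα n.cast_nonneg)
    have h2 := Nat.floor_le (mul_nonneg hβ n.cast_nonneg)
    have h3 : ((⌊α * n⌋₊ + ⌊β * n⌋₊ : ℕ) : ℝ) ≤ n := by
      push_cast
      nlinarith [(n.cast_nonneg : (0 : ℝ) ≤ n)]
    exact_mod_cast h3
  have hid : Tendsto (fun n : ℕ => n) atTop atTop := tendsto_id
  have ha : Tendsto (fun n : ℕ => (⌊α * n⌋₊ : ℝ) / n) atTop (𝓝 α) :=
    (tendsto_nat_floor_mul_div_atTop hα).comp tendsto_natCast_atTop_atTop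
  have hb : Tendsto (fun n : ℕ => (⌊β * n⌋₊ : ℝ) / n) atTop (𝓝 β) :=
    (tendsto_nat_floor_mul_div_atTop hβ).comp tendsto_natCast_atTop_atTop
  have hblue : Tendsto (fun n => (colorCount (c n) 0 : ℝ) / (n.choose 2 : ℝ)) atTop
      (𝓝 (α ^ 2)) := by
    have h := tendsto_div_choose hid (tendsto_choose_div_pow hid ha 2)
    rw [div_mul_cancel₀ _ (by positivity)] at h
    exact h.congr fun n => by rw [colorCount_extremalColoring_zero (hle n)]
  have hred : Tendsto (fun n => (colorCount (c n) 2 : ℝ) / (n.choose 2 : ℝ)) atTop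
      (𝓝 (2 * α * β)) := by
    have h := tendsto_div_choose hid (k := 2)
      (f := fun n : ℕ => (⌊α * n⌋₊ : ℝ) * ⌊β * n⌋₊) (l := α * β)
      ((ha.mul hb).congr fun n => by rw [div_mul_div_comm, sq])
    rw [Nat.factorial_two, mul_comm, ← mul_assoc] at h
    exact_mod_cast h.congr fun n => by
      rw [colorCount_extremalColoring_two (hle n)]
      push_cast
      rfl
  refine ⟨hblue, ?_, ?_⟩
  · refine ((tendsto_const_nhds.sub hblue).sub hred).congr' ?_
    filter_upwards [eventually_ge_atTop 2] with n hn
    have h0 : (n.choose 2 : ℝ) ≠ 0 := by exact_mod_cast (Nat.choose_pos hn).ne'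
    have hs : (colorCount (c n) 0 + colorCount (c n) 1 + colorCount (c n) 2 : ℝ) =
      n.choose 2 := by exact_mod_cast sum_colorCount (c n)
    field_simp
    linarith
  · have hlow : Tendsto (fun n : ℕ => ((⌊α * n⌋₊.choose s : ℝ) * ⌊β * n⌋₊.choose s) /
        (n.choose (s + s) : ℝ)) atTop
        (𝓝 ((2 * α * β / 2) ^ s * ((2 * s).choose s : ℝ))) := by
      rw [← factorial_two_mul_div]
      refine tendsto_div_choose hid ?_
      have h := (tendsto_choose_div_pow hid ha s).mul (tendsto_choose_div_pow hid hb s)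
      have he : α ^ s / s.factorial * (β ^ s / s.factorial) =
          (2 * α * β / 2) ^ s / (s.factorial : ℝ) ^ 2 := by
        rw [div_mul_div_comm, ← mul_pow, ← sq]
        congr 2
        ring
      rw [he] at h
      exact h.congr fun n => by rw [div_mul_div_comm, ← pow_add]
    refine tendsto_of_tendsto_of_tendsto_of_le_of_le hlow
      (tendsto_matching_bound s hid hred) ?_ ?_
    · intro n
      simp only
      gcongr
      exact_mod_cast choose_mul_choose_le_kstCopies s s (hle n)
    · intro n
      simp only
      gcongr
      exact kstCopies_le_matching_bound hs (isSymmColoring_extremalColoring _ _ _)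

/-- For `s ≥ 2` and `√x_b + √x_g > 1` with `x_r = 1 - x_b - x_g ≥ 0`,
`I₃(K'_{s,s}, (x_b, x_g)) = (x_r/2)^s · C(2s, s)`. -/
theorem I3_eq_of_sqrt_gt (s : ℕ) (hs : 2 ≤ s) (xb xg : ℝ)
    (hxb : 0 ≤ xb) (hxg : 0 ≤ xg) (hsum : xb + xg ≤ 1)
    (h : 1 < Real.sqrt xb + Real.sqrt xg) :
    I3 s s xb xg = ((1 - xb - xg) / 2) ^ s * ((2 * s).choose s : ℝ) := by
  refine IsGreatest.csSup_eq ⟨?_, ?_⟩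
  · have hb1 : √xb ≤ 1 := Real.sqrt_le_one.2 (by linarith)
    have hg1 : √xg ≤ 1 := Real.sqrt_le_one.2 (by linarith)
    have hb0 : 0 < √xb := by linarith
    have hbs : √xb ^ 2 = xb := Real.sq_sqrt hxb
    have hgs : √xg ^ 2 = xg := Real.sq_sqrt hxg
    set β := (1 - xb - xg) / (2 * √xb) with hβ
    have hβ0 : 0 ≤ β := div_nonneg (by linarith) (by positivity)
    have hr : 2 * √xb * β = 1 - xb - xg := mul_div_cancel₀ _ (by positivity)
    have hle : √xb + β ≤ 1 := by
      rw [← le_sub_iff_add_le', hβ, div_le_iff₀ (by positivity)]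
      nlinarith
    obtain ⟨h0, h1, hk⟩ := tendsto_extremalColoring hs hb0.le hβ0 hle
    rw [hbs, hr] at h1
    rw [hbs] at h0
    rw [hr] at hk
    refine ⟨fun n => n, fun n => extremalColoring ⌊√xb * n⌋₊ ⌊β * n⌋₊ n,
      fun n => isSymmColoring_extremalColoring _ _ _, tendsto_id, h0, ?_, hk⟩
    simpa using h1
  · rintro y ⟨V, c, hc, hV, hb, hg, hy⟩
    refine le_of_tendsto_of_tendsto' hy
      (tendsto_matching_bound s hV (tendsto_colorCount_two hV hb hg)) fun n => ?_
    gcongr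
    exact kstCopies_le_matching_bound hs (hc n)
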